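/- There do not exist an open interval I ⊆ ℝ containing 0, smooth functions x, y, r, c : I → ℝ with r > 0 on I, real numbers α, β with α·β ≠ 0, and a point τ₀ ∈ I with c(τ₀) ≠ 0, such that on I: x''(τ) = α·τ·r(τ)², y'' = β·r², r'' = r + c·r², c'' = c, and x'² + y'² + r'² = r². -/

import Mathlib

open Set

namespace CaseVII

open Polynomial

/-- First quartic. -/
def Pf {S : Type*} [CommRing S] (c d N h g u : S) : S :=
  4 * (N * u + c) ^ 3 * (1 + c * u)
    - (3 * h * u + 2 * d) * (2 * (2 * h * u * (N * u + c) + d * (N * u + c))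
        - N * u * (3 * h * u + 2 * d))
    + 2 * (N * u + c) ^ 2 * (3 * g * u + 2 * c)
    - 2 * (3 * h * u + 2 * d) * (N * u + c) * (3 * h * u + d)

/-- Second quartic. -/
def Qf {S : Type*} [CommRing S] (M e f v c d N h u : S) : S :=
  M * (2 * (N * u + c) ^ 2 - d * (3 * h * u + 2 * d)) ^ 2
    + 2 * e * c * (3 * h * u + 2 * d) * (2 * (N * u + c) ^ 2 - d * (3 * h * u + 2 * d))
    + f * c ^ 2 * (3 * h * u + 2 * d) ^ 2
    + v * ((3 * h * u + 2 * d) ^ 2 - 4 * (N * u + c) ^ 2)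

lemma Pf_map {S T : Type*} [CommRing S] [CommRing T] (φ : S →+* T) (c d N h g u : S) :
    φ (Pf c d N h g u) = Pf (φ c) (φ d) (φ N) (φ h) (φ g) (φ u) := by
  simp only [Pf, map_add, map_sub, map_mul, map_pow, map_one, map_ofNat]

lemma Qf_map {S T : Type*} [CommRing S] [CommRing T] (φ : S →+* T) (M e f v c d N h u : S) :
    φ (Qf M e f v c d N h u) =
      Qf (φ M) (φ e) (φ f) (φ v) (φ c) (φ d) (φ N) (φ h) (φ u) := by
  simp only [Qf, map_add, map_sub, map_mul, map_pow, map_one, map_ofNat]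

lemma Pf_deg {S : Type*} [CommRing S] (c d N h g : S) :
    (Pf (C c) (C d) (C N) (C h) (C g) X : S[X]).natDegree ≤ 4 := by
  unfold Pf
  compute_degree

lemma Qf_deg {S : Type*} [CommRing S] (M e f v c d N h : S) :
    (Qf (C M) (C e) (C f) (C v) (C c) (C d) (C N) (C h) X : S[X]).natDegree ≤ 4 := by
  unfold Qf
  compute_degree

/-- `exp` is transcendental, in the form we need. -/
lemma transc (F : ℝ[X][X]) (κ lo hi : ℝ) (hκ : κ ≠ 0) (hlt : lo < hi)
    (H : ∀ τ ∈ Ioo lo hi, (F.map (evalRingHom (κ * Real.exp (-τ)))).eval τ = 0) : F = 0 := by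
  -- complexify
  let G : ℂ → ℂ := fun z => ∑ i ∈ Finset.range (F.natDegree + 1),
    ((F.coeff i).map Complex.ofRealHom).eval (κ * Complex.exp (-z)) * z ^ i
  have hGd : Differentiable ℂ G := by
    intro z
    refine DifferentiableAt.fun_sum fun i _ => ?_
    refine DifferentiableAt.mul ?_ (by fun_prop)
    exact ((Polynomial.differentiable _).differentiableAt).comp z
      (by fun_prop : DifferentiableAt ℂ (fun z => (κ : ℂ) * Complex.exp (-z)) z)
  have hG0 : ∀ τ ∈ Ioo lo hi, G (τ : ℂ) = 0 := by
    intro τ hτ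
    have h1 := H τ hτ
    rw [eval_eq_sum_range' (n := F.natDegree + 1)
      (Nat.lt_succ_of_le (natDegree_map_le))] at h1
    have h2 := congrArg (fun x : ℝ => (x : ℂ)) h1
    simp only [Complex.ofReal_zero] at h2
    rw [← h2]
    push_cast
    refine Finset.sum_congr rfl fun i _ => ?_
    rw [coeff_map, coe_evalRingHom]
    congr 1
    have : ((κ : ℂ) * Complex.exp (-(τ : ℂ))) = Complex.ofRealHom (κ * Real.exp (-τ)) := by
      simp
    rw [this, eval_map, eval₂_at_apply]
    rfl
  have hGz : ∀ z, G z = 0 := by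
    have han : AnalyticOnNhd ℂ G univ := fun z _ => hGd.analyticAt z
    let m := (lo + hi) / 2
    have hfreq : ∃ᶠ z in nhdsWithin (m : ℂ) {(m : ℂ)}ᶜ, G z = 0 := by
      have hm : m ∈ Ioo lo hi := ⟨by simp only [m]; linarith, by simp only [m]; linarith⟩
      have ht : Filter.Tendsto (fun x : ℝ => (x : ℂ)) (nhdsWithin m {m}ᶜ)
          (nhdsWithin (m : ℂ) {(m : ℂ)}ᶜ) := by
        refine tendsto_nhdsWithin_iff.2 ⟨?_, ?_⟩
        · exact (Complex.continuous_ofReal.tendsto m).mono_left nhdsWithin_le_nhds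
        · filter_upwards [self_mem_nhdsWithin] with x hx
          simpa using hx
      refine ht.frequently (p := fun z => G z = 0) ?_
      refine Filter.Eventually.frequently ?_
      filter_upwards [nhdsWithin_le_nhds (Ioo_mem_nhds hm.1 hm.2)] with x hx
      exact hG0 x hx
    intro z
    exact han.eqOn_zero_of_preconnected_of_frequently_eq_zero isPreconnected_univ
      (mem_univ _) hfreq (mem_univ z)
  have hcoef : ∀ (τ : ℝ) (i : ℕ), (F.coeff i).eval (κ * Real.exp (-τ)) = 0 := by
    intro τ i
    let p : ℂ[X] := F.map (Complex.ofRealHom.comp (evalRingHom (κ * Real.exp (-τ))))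
    have hp : p = 0 := by
      refine Polynomial.eq_zero_of_infinite_isRoot p ?_
      refine Set.Infinite.mono (s := range fun n : ℕ => (τ : ℂ) + n * (2 * Real.pi * Complex.I)) ?_ ?_
      · rintro _ ⟨n, rfl⟩
        have h1 := hGz ((τ : ℂ) + n * (2 * Real.pi * Complex.I))
        show p.eval _ = 0
        rw [eval_eq_sum_range' (n := F.natDegree + 1)
          (Nat.lt_succ_of_le (natDegree_map_le)), ← h1]
        refine Finset.sum_congr rfl fun i _ => ?_
        simp only [p]
        rw [coeff_map]
        congr 1
        have e1 : Complex.exp (-((τ : ℂ) + n * (2 * Real.pi * Complex.I))) =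
            Complex.exp (-(τ : ℂ)) := by
          rw [neg_add, ← sub_eq_add_neg, Complex.exp_sub, Complex.exp_nat_mul_two_pi_mul_I,
            div_one]
        have : ((κ : ℂ) * Complex.exp (-(τ : ℂ))) = Complex.ofRealHom (κ * Real.exp (-τ)) := by
          simp
        rw [e1, this, eval_map, eval₂_at_apply]
        rfl
      · refine Set.infinite_range_of_injective ?_
        intro a b hab
        have h2 : (2 * Real.pi * Complex.I : ℂ) ≠ 0 := Complex.two_pi_I_ne_zero
        have h3 := mul_right_cancel₀ h2 (add_left_cancel hab)
        exact_mod_cast h3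
    have := congrArg (fun q => coeff q i) hp
    simpa [p] using this
  ext1 i
  rw [coeff_zero]
  refine Polynomial.eq_zero_of_infinite_isRoot _ ?_
  refine Set.Infinite.mono (s := range fun t : ℝ => κ * Real.exp (-t)) ?_ ?_
  · rintro _ ⟨t, rfl⟩
    exact hcoef t i
  · refine Set.infinite_range_of_injective ?_
    intro a b hab
    have := Real.exp_injective (mul_left_cancel₀ hκ hab)
    linarith

lemma cop0 (α β : ℝ) (hα : α ≠ 0) (hβ : β ≠ 0) :
    resultant (Pf (C 1) (C 1) (C 1) (C 1) (C 2) X : ℝ[X])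
      (Qf (C (β ^ 2)) (C 0) (C (α ^ 2)) (C 0) (C 1) (C 1) (C 1) (C 1) X) 4 4 ≠ 0 := by
  have hPd : (Pf (C 1) (C 1) (C 1) (C 1) (C 2) X : ℝ[X]).natDegree = 4 := by
    refine le_antisymm (Pf_deg _ _ _ _ _) (le_natDegree_of_ne_zero ?_)
    have : (Pf (C 1) (C 1) (C 1) (C 1) (C 2) X : ℝ[X]) =
      C 4 * X ^ 4 + C 7 * X ^ 3 + C 2 * X ^ 2 := by
      unfold Pf
      simp only [map_ofNat, map_one]
      ring
    rw [this]
    simp [coeff_X_pow]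
  have hQd : (Qf (C (β ^ 2)) (C 0) (C (α ^ 2)) (C 0) (C 1) (C 1) (C 1) (C 1) X :
      ℝ[X]).natDegree = 4 := by
    refine le_antisymm (Qf_deg _ _ _ _ _ _ _ _) (le_natDegree_of_ne_zero ?_)
    have : (Qf (C (β ^ 2)) (C 0) (C (α ^ 2)) (C 0) (C 1) (C 1) (C 1) (C 1) X : ℝ[X]) =
      C (4 * β ^ 2) * X ^ 4 + C (4 * β ^ 2) * X ^ 3 + C (β ^ 2 + 9 * α ^ 2) * X ^ 2
        + C (12 * α ^ 2) * X + C (4 * α ^ 2) := by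
      unfold Qf
      simp only [map_ofNat, map_one, map_zero, map_mul, map_add]
      ring
    rw [this]
    simp only [coeff_add, coeff_C_mul, coeff_X_pow, coeff_X, coeff_C]
    simp [hβ]
  have key : ∀ a : ℝ, IsCoprime (X - C a) (Qf (C (β ^ 2)) (C 0) (C (α ^ 2)) (C 0) (C 1)
      (C 1) (C 1) (C 1) X : ℝ[X]) := by
    intro a
    rw [(irreducible_X_sub_C a).coprime_iff_not_dvd, dvd_iff_isRoot]
    intro h
    have h : eval a _ = 0 := h
    rw [← coe_evalRingHom, Qf_map] at h
    simp only [coe_evalRingHom, eval_C, eval_X] at h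
    have h2 : (β * (2 * a ^ 2 + a)) ^ 2 + (α * (3 * a + 2)) ^ 2 = 0 := by
      unfold Qf at h
      linear_combination h
    have h3 : (β * (2 * a ^ 2 + a)) = 0 := by nlinarith [sq_nonneg (β * (2 * a ^ 2 + a)), sq_nonneg (α * (3 * a + 2))]
    have h4 : (α * (3 * a + 2)) = 0 := by nlinarith [sq_nonneg (β * (2 * a ^ 2 + a)), sq_nonneg (α * (3 * a + 2))]
    have h5 := (mul_eq_zero.1 h3).resolve_left hβ
    have h6 := (mul_eq_zero.1 h4).resolve_left hα
    have : a = -2/3 := by linarith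
    subst this
    norm_num at h5
  have hc : IsCoprime (Pf (C 1) (C 1) (C 1) (C 1) (C 2) X : ℝ[X])
      (Qf (C (β ^ 2)) (C 0) (C (α ^ 2)) (C 0) (C 1) (C 1) (C 1) (C 1) X) := by
    have : (Pf (C 1) (C 1) (C 1) (C 1) (C 2) X : ℝ[X]) =
        C 4 * ((X - C 0) * (X - C 0) * (X - C ((-7 + √17) / 8)) * (X - C ((-7 - √17) / 8))) := by
      have h17 : √17 * √17 = (17 : ℝ) := Real.mul_self_sqrt (by norm_num)
      refine Polynomial.funext fun t => ?_
      rw [← coe_evalRingHom, Pf_map]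
      simp only [coe_evalRingHom, eval_C, eval_X, eval_mul, eval_sub, Pf]
      linear_combination (t ^ 2 / 16) * h17
    rw [this]
    have hu : IsUnit (C 4 : ℝ[X]) := isUnit_C.2 (by norm_num)
    rw [isCoprime_mul_unit_left_left hu]
    exact (((key _).mul_left (key _)).mul_left (key _)).mul_left (key _)
  have := resultant_ne_zero _ _ hc
  rwa [hPd, hQd] at this

lemma res_zero {S : Type*} [CommRing S] (P Q : S[X]) (hP : P.natDegree ≤ 4)
    (hQ : Q.natDegree ≤ 4) (u : S) (h1 : P.eval u = 0) (h2 : Q.eval u = 0) :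
    resultant P Q 4 4 = 0 := by
  obtain ⟨p, q, -, -, h⟩ := exists_mul_add_mul_eq_C_resultant P Q hP hQ (Or.inl four_ne_zero)
  have := congrArg (eval u) h
  simpa [h1, h2] using this.symm

lemma core (α β k κ lo hi : ℝ) (hα : α ≠ 0) (hβ : β ≠ 0) (hκ : κ ≠ 0) (hlt : lo < hi)
    (H : ∀ τ ∈ Ioo lo hi, ∃ w u : ℝ, w = κ * Real.exp (-τ) ∧
      Pf (1 + k * w ^ 2) (1 - k * w ^ 2)
        ((1 + k * w ^ 2) ^ 2 + w ^ 2 * (α ^ 2 * τ ^ 2 + β ^ 2))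
        (α ^ 2 * τ * w ^ 2 + (1 + k * w ^ 2) * (1 - k * w ^ 2))
        (α ^ 2 * w ^ 2 + (1 - k * w ^ 2) ^ 2 + (1 + k * w ^ 2) ^ 2) u = 0 ∧
      Qf (α ^ 2 * τ ^ 2 + β ^ 2) (α ^ 2 * τ) (α ^ 2) (α ^ 2 * β ^ 2 * w ^ 2)
        (1 + k * w ^ 2) (1 - k * w ^ 2)
        ((1 + k * w ^ 2) ^ 2 + w ^ 2 * (α ^ 2 * τ ^ 2 + β ^ 2))
        (α ^ 2 * τ * w ^ 2 + (1 + k * w ^ 2) * (1 - k * w ^ 2)) u = 0) : False := by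
  let a : ℝ[X][X] := C (C α)
  let b : ℝ[X][X] := C (C β)
  let K : ℝ[X][X] := C (C k)
  let w : ℝ[X][X] := C X
  let t : ℝ[X][X] := X
  let P : ℝ[X][X][X] := Pf (C (1 + K * w ^ 2)) (C (1 - K * w ^ 2))
        (C ((1 + K * w ^ 2) ^ 2 + w ^ 2 * (a ^ 2 * t ^ 2 + b ^ 2)))
        (C (a ^ 2 * t * w ^ 2 + (1 + K * w ^ 2) * (1 - K * w ^ 2)))
        (C (a ^ 2 * w ^ 2 + (1 - K * w ^ 2) ^ 2 + (1 + K * w ^ 2) ^ 2)) X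
  let Q : ℝ[X][X][X] := Qf (C (a ^ 2 * t ^ 2 + b ^ 2)) (C (a ^ 2 * t)) (C (a ^ 2))
        (C (a ^ 2 * b ^ 2 * w ^ 2))
        (C (1 + K * w ^ 2)) (C (1 - K * w ^ 2))
        (C ((1 + K * w ^ 2) ^ 2 + w ^ 2 * (a ^ 2 * t ^ 2 + b ^ 2)))
        (C (a ^ 2 * t * w ^ 2 + (1 + K * w ^ 2) * (1 - K * w ^ 2))) X
  let φ : ℝ → ℝ → ℝ[X][X] →+* ℝ := fun τ w => (evalRingHom τ).comp (mapRingHom (evalRingHom w))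
  have φa : ∀ τ v, φ τ v a = α := by intro τ v; simp [φ, a]
  have φb : ∀ τ v, φ τ v b = β := by intro τ v; simp [φ, b]
  have φK : ∀ τ v, φ τ v K = k := by intro τ v; simp [φ, K]
  have φw : ∀ τ v, φ τ v w = v := by intro τ v; simp [φ, w]
  have φt : ∀ τ v, φ τ v t = τ := by intro τ v; simp [φ, t]
  have hF : resultant P Q 4 4 = 0 := by
    refine transc _ κ lo hi hκ hlt fun τ hτ => ?_
    obtain ⟨v, u, hv, h1, h2⟩ := H τ hτ
    rw [← hv]
    change φ τ v _ = 0
    rw [← resultant_map_map]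
    refine res_zero _ _ (natDegree_map_le.trans (Pf_deg _ _ _ _ _))
      (natDegree_map_le.trans (Qf_deg _ _ _ _ _ _ _ _)) u ?_ ?_
    · rw [← h1, ← coe_evalRingHom, ← coe_mapRingHom, ← RingHom.comp_apply, Pf_map]
      simp only [RingHom.comp_apply, coe_mapRingHom, map_C, map_X, coe_evalRingHom, eval_C, eval_X,
        map_add, map_mul, map_pow, map_sub, map_one, φa, φb, φK, φw, φt]
    · rw [← h2, ← coe_evalRingHom, ← coe_mapRingHom, ← RingHom.comp_apply, Qf_map]
      simp only [RingHom.comp_apply, coe_mapRingHom, map_C, map_X, coe_evalRingHom, eval_C, eval_X,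
        map_add, map_mul, map_pow, map_sub, map_one, φa, φb, φK, φw, φt]
  have h0 := congrArg (φ 0 0) hF
  rw [← resultant_map_map, map_zero] at h0
  refine cop0 α β hα hβ ?_
  convert h0 using 2
  · rw [← coe_mapRingHom, Pf_map]
    simp only [coe_mapRingHom, map_C, map_X, map_add, map_mul, map_pow, map_sub, map_one,
      φa, φb, φK, φw, φt]
    norm_num
    try simp only [map_ofNat]
  · rw [← coe_mapRingHom, Qf_map]
    simp only [coe_mapRingHom, map_C, map_X, map_add, map_mul, map_pow, map_sub, map_one,
      φa, φb, φK, φw, φt]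
    norm_num

lemma core' (α β A B lo hi : ℝ) (hα : α ≠ 0) (hβ : β ≠ 0) (hA : A ≠ 0) (hlt : lo < hi)
    (H : ∀ τ ∈ Ioo lo hi, ∃ c d r : ℝ, c = A * Real.exp τ + B * Real.exp (-τ) ∧
      d = A * Real.exp τ - B * Real.exp (-τ) ∧
      Pf c d (α ^ 2 * τ ^ 2 + β ^ 2 + c ^ 2) (α ^ 2 * τ + c * d) (α ^ 2 + d ^ 2 + c ^ 2) r = 0 ∧
      Qf (α ^ 2 * τ ^ 2 + β ^ 2) (α ^ 2 * τ) (α ^ 2) (α ^ 2 * β ^ 2) c d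
        (α ^ 2 * τ ^ 2 + β ^ 2 + c ^ 2) (α ^ 2 * τ + c * d) r = 0) : False := by
  refine core α β (A * B) A⁻¹ lo hi hα hβ (inv_ne_zero hA) hlt fun τ hτ => ?_
  obtain ⟨c, d, r, hc, hd, h1, h2⟩ := H τ hτ
  have hs : A * Real.exp τ ≠ 0 := mul_ne_zero hA (Real.exp_ne_zero _)
  refine ⟨A⁻¹ * Real.exp (-τ), A * Real.exp τ * r, rfl, ?_, ?_⟩
  all_goals
    generalize hw : A⁻¹ * Real.exp (-τ) = w
    have hBe : B * Real.exp (-τ) = A * B * w := by rw [← hw]; field_simp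
    have hsw : (A * Real.exp τ) * w = 1 := by
      rw [← hw, Real.exp_neg]
      have := Real.exp_ne_zero τ
      field_simp
    rw [hBe] at hc hd
    generalize A * B = k at *
    generalize A * Real.exp τ = s at *
    have hw' : w = s⁻¹ := eq_inv_of_mul_eq_one_right hsw
    subst hw' hc hd
  · have : s ^ 3 * Pf (1 + k * s⁻¹ ^ 2) (1 - k * s⁻¹ ^ 2)
        ((1 + k * s⁻¹ ^ 2) ^ 2 + s⁻¹ ^ 2 * (α ^ 2 * τ ^ 2 + β ^ 2))
        (α ^ 2 * τ * s⁻¹ ^ 2 + (1 + k * s⁻¹ ^ 2) * (1 - k * s⁻¹ ^ 2))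
        (α ^ 2 * s⁻¹ ^ 2 + (1 - k * s⁻¹ ^ 2) ^ 2 + (1 + k * s⁻¹ ^ 2) ^ 2) (s * r) = 0 := by
      rw [← h1]
      unfold Pf
      field_simp
      ring
    exact (mul_eq_zero.1 this).resolve_left (pow_ne_zero _ hs)
  · have : s ^ 4 * Qf (α ^ 2 * τ ^ 2 + β ^ 2) (α ^ 2 * τ) (α ^ 2) (α ^ 2 * β ^ 2 * s⁻¹ ^ 2)
        (1 + k * s⁻¹ ^ 2) (1 - k * s⁻¹ ^ 2)
        ((1 + k * s⁻¹ ^ 2) ^ 2 + s⁻¹ ^ 2 * (α ^ 2 * τ ^ 2 + β ^ 2))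
        (α ^ 2 * τ * s⁻¹ ^ 2 + (1 + k * s⁻¹ ^ 2) * (1 - k * s⁻¹ ^ 2)) (s * r) = 0 := by
      rw [← h2]
      unfold Qf
      field_simp
      ring
    exact (mul_eq_zero.1 this).resolve_left (pow_ne_zero _ hs)

lemma Pf_alg (α β τ c d r p N h g D q : ℝ) (hr : r ≠ 0)
    (hD : D = N * r + c) (hq : q = 3 * h * r + 2 * d)
    (E3 : 2 * D * p + r * q = 0)
    (E4 : 2 * ((2 * h * r + N * p + d) * p + D * (r + c * r ^ 2)) + p * q
      + r * (3 * (g * r + h * p) + 2 * c) = 0) : Pf c d N h g r = 0 := by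
  have : r * Pf c d N h g r = 0 := by
    unfold Pf
    rw [← hD, ← hq]
    subst hq
    linear_combination 2 * D ^ 2 * E4 - (2 * D * (2 * h * r + d)
      + N * (2 * D * p - r * (3 * h * r + 2 * d)) + D * (3 * h * r + 2 * d) + 3 * D * r * h) * E3
  exact (mul_eq_zero.1 this).resolve_left hr

lemma Qf_alg (α β τ c d r p x y N h D q : ℝ) (hr : r ≠ 0)
    (hD : D = N * r + c) (hq : q = 3 * h * r + 2 * d)
    (E0 : x ^ 2 + y ^ 2 + p ^ 2 = r ^ 2)
    (E1 : α * τ * x + β * y + c * p = 0)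
    (E2 : α * x + r * D + d * p = 0)
    (E3 : 2 * D * p + r * q = 0) :
    Qf (α ^ 2 * τ ^ 2 + β ^ 2) (α ^ 2 * τ) (α ^ 2) (α ^ 2 * β ^ 2) c d N h r = 0 := by
  have h1 : 2 * D * (α * x) = - (r * (2 * D ^ 2 - d * q)) := by
    linear_combination 2 * D * E2 - d * E3
  have h2 : 2 * D * (β * y) = r * (c * q + τ * (2 * D ^ 2 - d * q)) := by
    linear_combination 2 * D * E1 - c * E3 - τ * h1
  have h3 : 2 * D * p = - (r * q) := by linear_combination E3
  have : r ^ 2 * Qf (α ^ 2 * τ ^ 2 + β ^ 2) (α ^ 2 * τ) (α ^ 2) (α ^ 2 * β ^ 2) c d N h r = 0 := by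
    unfold Qf
    rw [← hD, ← hq]
    linear_combination 4 * D ^ 2 * α ^ 2 * β ^ 2 * E0
      - β ^ 2 * (2 * D * (α * x) - (r * (2 * D ^ 2 - d * q))) * h1
      - α ^ 2 * (2 * D * (β * y) + r * (c * q + τ * (2 * D ^ 2 - d * q))) * h2
      - α ^ 2 * β ^ 2 * (2 * D * p - r * q) * h3
  exact (mul_eq_zero.1 this).resolve_left (pow_ne_zero _ hr)

lemma der_zero {lo hi : ℝ} {F F' : ℝ → ℝ} (h0 : ∀ τ ∈ Ioo lo hi, F τ = 0)
    (hF : ∀ τ ∈ Ioo lo hi, HasDerivAt F (F' τ) τ) : ∀ τ ∈ Ioo lo hi, F' τ = 0 := by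
  intro τ hτ
  have : F =ᶠ[nhds τ] fun _ => 0 := by
    filter_upwards [Ioo_mem_nhds hτ.1 hτ.2] with t ht using h0 t ht
  exact ((hF τ hτ).congr_of_eventuallyEq this.symm).unique (hasDerivAt_const τ 0)

lemma smooth_der {lo hi : ℝ} {f : ℝ → ℝ} (hf : ContDiffOn ℝ (⊤ : ℕ∞) f (Ioo lo hi)) :
    ∀ τ ∈ Ioo lo hi, HasDerivAt f (deriv f τ) τ ∧ HasDerivAt (deriv f) (deriv (deriv f) τ) τ := by
  intro τ hτ
  have hn := Ioo_mem_nhds hτ.1 hτ.2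
  refine ⟨((hf.contDiffAt hn).differentiableAt (by simp)).hasDerivAt, ?_⟩
  have h2 : ContDiffOn ℝ 1 (deriv f) (Ioo lo hi) :=
    ((contDiffOn_succ_iff_deriv_of_isOpen (n := 1) isOpen_Ioo).1 (hf.of_le (by
      have h : ((2 : ℕ∞) : WithTop ℕ∞) ≤ ((⊤ : ℕ∞) : WithTop ℕ∞) := WithTop.coe_le_coe.2 le_top
      rw [one_add_one_eq_two]
      exact h))).2.2
  exact ((h2.contDiffAt hn).differentiableAt (by simp)).hasDerivAt

lemma const_of_der {lo hi : ℝ} {F : ℝ → ℝ} 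
    (hF : ∀ τ ∈ Ioo lo hi, HasDerivAt F 0 τ) {s t : ℝ} (hs : s ∈ Ioo lo hi)
    (ht : t ∈ Ioo lo hi) : F s = F t := by
  refine isOpen_Ioo.is_const_of_deriv_eq_zero isPreconnected_Ioo ?_ ?_ hs ht
  · exact fun τ hτ => (hF τ hτ).differentiableAt.differentiableWithinAt
  · exact fun τ hτ => (hF τ hτ).deriv

end CaseVII

open CaseVII in
/-- Exclusion of Case (VII) in normalized form: `a(τ) = ατ`, `b ≡ β` with
`αβ ≠ 0`, and `c ≠ 0` at some point is impossible. -/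
theorem case_VII_cannot_occur :
    ¬ ∃ (lo hi : ℝ) (x y r c : ℝ → ℝ) (α β τ₀ : ℝ),
      (0 : ℝ) ∈ Ioo lo hi ∧
      ContDiffOn ℝ (⊤ : ℕ∞) x (Ioo lo hi) ∧
      ContDiffOn ℝ (⊤ : ℕ∞) y (Ioo lo hi) ∧
      ContDiffOn ℝ (⊤ : ℕ∞) r (Ioo lo hi) ∧
      ContDiffOn ℝ (⊤ : ℕ∞) c (Ioo lo hi) ∧
      (∀ τ ∈ Ioo lo hi, 0 < r τ) ∧
      α * β ≠ 0 ∧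
      τ₀ ∈ Ioo lo hi ∧ c τ₀ ≠ 0 ∧
      (∀ τ ∈ Ioo lo hi, deriv (deriv x) τ = α * τ * r τ ^ 2) ∧
      (∀ τ ∈ Ioo lo hi, deriv (deriv y) τ = β * r τ ^ 2) ∧
      (∀ τ ∈ Ioo lo hi, deriv (deriv r) τ = r τ + c τ * r τ ^ 2) ∧
      (∀ τ ∈ Ioo lo hi, deriv (deriv c) τ = c τ) ∧
      (∀ τ ∈ Ioo lo hi,
        deriv x τ ^ 2 + deriv y τ ^ 2 + deriv r τ ^ 2 = r τ ^ 2) := by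
  rintro ⟨lo, hi, x, y, r, c, α, β, τ₀, hz, hx, hy, hr, hc, hpos, hαβ, hτ₀, hc0, ex, ey, er, ec, E0⟩
  have hα := left_ne_zero_of_mul hαβ
  have hβ := right_ne_zero_of_mul hαβ
  have dx : ∀ τ ∈ Ioo lo hi, HasDerivAt (deriv x) (α * τ * r τ ^ 2) τ := fun τ hτ =>
    ex τ hτ ▸ (smooth_der hx τ hτ).2
  have dy : ∀ τ ∈ Ioo lo hi, HasDerivAt (deriv y) (β * r τ ^ 2) τ := fun τ hτ =>
    ey τ hτ ▸ (smooth_der hy τ hτ).2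
  have dp : ∀ τ ∈ Ioo lo hi, HasDerivAt (deriv r) (r τ + c τ * r τ ^ 2) τ := fun τ hτ =>
    er τ hτ ▸ (smooth_der hr τ hτ).2
  have dd : ∀ τ ∈ Ioo lo hi, HasDerivAt (deriv c) (c τ) τ := fun τ hτ => by
    have := (smooth_der hc τ hτ).2
    rwa [ec τ hτ] at this
  have dr : ∀ τ ∈ Ioo lo hi, HasDerivAt r (deriv r τ) τ := fun τ hτ => (smooth_der hr τ hτ).1
  have dc : ∀ τ ∈ Ioo lo hi, HasDerivAt c (deriv c τ) τ := fun τ hτ => (smooth_der hc τ hτ).1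
  clear ex ey er ec hx hy hr hc
  generalize deriv x = X at *
  generalize deriv y = Y at *
  generalize deriv r = p at *
  generalize deriv c = d at *
  have E1 : ∀ τ ∈ Ioo lo hi, α * τ * X τ + β * Y τ + c τ * p τ = 0 := by
    have := der_zero (lo := lo) (hi := hi)
      (F := fun τ => X τ * X τ + Y τ * Y τ + p τ * p τ - r τ * r τ)
      (fun τ hτ => by linear_combination E0 τ hτ)
      (fun τ hτ => ((((dx τ hτ).mul (dx τ hτ)).add ((dy τ hτ).mul (dy τ hτ))).add
        ((dp τ hτ).mul (dp τ hτ))).sub ((dr τ hτ).mul (dr τ hτ)))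
    intro τ hτ
    have h1 := this τ hτ
    have h2 : (2 * r τ ^ 2) * (α * τ * X τ + β * Y τ + c τ * p τ) = 0 := by
      linear_combination h1
    exact (mul_eq_zero.1 h2).resolve_left (by have := hpos τ hτ; positivity)
  have E2 : ∀ τ ∈ Ioo lo hi, α * X τ +
      r τ * ((α ^ 2 * τ ^ 2 + β ^ 2 + c τ ^ 2) * r τ + c τ) + d τ * p τ = 0 := by
    have := der_zero (lo := lo) (hi := hi)
      (F := fun τ => (α * τ) * X τ + β * Y τ + c τ * p τ)
      (fun τ hτ => by linear_combination E1 τ hτ)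
      (fun τ hτ => (((((hasDerivAt_id τ).const_mul α).mul (dx τ hτ)).add
        ((dy τ hτ).const_mul β)).add ((dc τ hτ).mul (dp τ hτ))))
    intro τ hτ
    have h1 := this τ hτ
    simp only [id] at h1
    linear_combination h1
  have dN : ∀ τ ∈ Ioo lo hi, HasDerivAt (fun τ => α ^ 2 * (τ * τ) + β ^ 2 + c τ * c τ)
      (2 * (α ^ 2 * τ + c τ * d τ)) τ := fun τ hτ => by
    refine HasDerivAt.congr_deriv (((((hasDerivAt_id τ).mul (hasDerivAt_id τ)).const_mul
      (α ^ 2)).add_const (β ^ 2)).add ((dc τ hτ).mul (dc τ hτ))) ?_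
    simp only [id]
    ring
  have dh : ∀ τ ∈ Ioo lo hi, HasDerivAt (fun τ => α ^ 2 * τ + c τ * d τ)
      (α ^ 2 + d τ ^ 2 + c τ ^ 2) τ := fun τ hτ => by
    refine HasDerivAt.congr_deriv (((hasDerivAt_id τ).const_mul (α ^ 2)).add
      ((dc τ hτ).mul (dd τ hτ))) ?_
    ring
  have E3 : ∀ τ ∈ Ioo lo hi, 2 * ((α ^ 2 * τ ^ 2 + β ^ 2 + c τ ^ 2) * r τ + c τ) * p τ
      + r τ * (3 * (α ^ 2 * τ + c τ * d τ) * r τ + 2 * d τ) = 0 := by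
    have := der_zero (lo := lo) (hi := hi)
      (F := fun τ => α * X τ + r τ * ((α ^ 2 * (τ * τ) + β ^ 2 + c τ * c τ) * r τ + c τ)
        + d τ * p τ)
      (fun τ hτ => by linear_combination E2 τ hτ)
      (fun τ hτ => (((dx τ hτ).const_mul α).add
        ((dr τ hτ).mul (((dN τ hτ).mul (dr τ hτ)).add (dc τ hτ)))).add
        ((dd τ hτ).mul (dp τ hτ)))
    intro τ hτ
    have h1 := this τ hτ
    simp at h1
    linear_combination h1
  have E4 := der_zero (lo := lo) (hi := hi)
      (F := fun τ => 2 * (((α ^ 2 * (τ * τ) + β ^ 2 + c τ * c τ) * r τ + c τ) * p τ)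
        + r τ * (3 * ((α ^ 2 * τ + c τ * d τ) * r τ) + 2 * d τ))
      (fun τ hτ => by linear_combination E3 τ hτ)
      (fun τ hτ => (((((dN τ hτ).mul (dr τ hτ)).add (dc τ hτ)).mul (dp τ hτ)).const_mul 2).add
        ((dr τ hτ).mul ((((dh τ hτ).mul (dr τ hτ)).const_mul 3).add ((dd τ hτ).const_mul 2))))
  have HP : ∀ τ ∈ Ioo lo hi, Pf (c τ) (d τ) (α ^ 2 * τ ^ 2 + β ^ 2 + c τ ^ 2)
      (α ^ 2 * τ + c τ * d τ) (α ^ 2 + d τ ^ 2 + c τ ^ 2) (r τ) = 0 := fun τ hτ => by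
    refine Pf_alg α β τ _ _ _ (p τ) _ _ _ _ _ (hpos τ hτ).ne' rfl rfl (E3 τ hτ) ?_
    have h1 := E4 τ hτ
    simp at h1
    linear_combination h1
  have HQ : ∀ τ ∈ Ioo lo hi, Qf (α ^ 2 * τ ^ 2 + β ^ 2) (α ^ 2 * τ) (α ^ 2) (α ^ 2 * β ^ 2)
      (c τ) (d τ) (α ^ 2 * τ ^ 2 + β ^ 2 + c τ ^ 2)
      (α ^ 2 * τ + c τ * d τ) (r τ) = 0 := fun τ hτ =>
    Qf_alg α β τ _ _ _ (p τ) (X τ) (Y τ) _ _ _ _ (hpos τ hτ).ne' rfl rfl (E0 τ hτ) (E1 τ hτ)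
      (E2 τ hτ) (E3 τ hτ)
  have hA : ∀ τ ∈ Ioo lo hi, (c τ + d τ) * Real.exp (-τ) = (c 0 + d 0) * Real.exp (-0) :=
    fun τ hτ => by
      refine const_of_der (F := fun τ => (c τ + d τ) * Real.exp (-τ)) (fun t ht => ?_) hτ hz
      refine HasDerivAt.congr_deriv (((dc t ht).add (dd t ht)).mul (hasDerivAt_neg t).exp) ?_
      simp only [Pi.add_apply]
      ring
  have hB : ∀ τ ∈ Ioo lo hi, (c τ - d τ) * Real.exp τ = (c 0 - d 0) * Real.exp 0 :=
    fun τ hτ => by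
      refine const_of_der (F := fun τ => (c τ - d τ) * Real.exp τ) (fun t ht => ?_) hτ hz
      refine HasDerivAt.congr_deriv (((dc t ht).sub (dd t ht)).mul (Real.hasDerivAt_exp t)) ?_
      simp only [Pi.sub_apply]
      ring
  simp only [neg_zero, Real.exp_zero, mul_one] at hA hB
  have hee : ∀ τ : ℝ, Real.exp τ * Real.exp (-τ) = 1 := fun τ => by
    rw [← Real.exp_add]; simp
  have hcf : ∀ τ ∈ Ioo lo hi, c τ = (c 0 + d 0) / 2 * Real.exp τ
      + (c 0 - d 0) / 2 * Real.exp (-τ) := fun τ hτ => by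
    linear_combination (-c τ) * hee τ + Real.exp τ / 2 * hA τ hτ + Real.exp (-τ) / 2 * hB τ hτ
  have hdf : ∀ τ ∈ Ioo lo hi, d τ = (c 0 + d 0) / 2 * Real.exp τ
      - (c 0 - d 0) / 2 * Real.exp (-τ) := fun τ hτ => by
    linear_combination (-d τ) * hee τ + Real.exp τ / 2 * hA τ hτ - Real.exp (-τ) / 2 * hB τ hτ
  by_cases h1 : (c 0 + d 0) / 2 = 0
  · have h2 : (c 0 - d 0) / 2 ≠ 0 := by
      intro h2
      apply hc0
      rw [hcf τ₀ hτ₀, h1, h2]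
      ring
    refine core' α β _ ((c 0 + d 0) / 2) (-hi) (-lo) hα hβ h2 (by linarith [hz.1, hz.2])
      fun τ hτ => ?_
    have hτ' : -τ ∈ Ioo lo hi := ⟨by linarith [hτ.2], by linarith [hτ.1]⟩
    refine ⟨c (-τ), - d (-τ), r (-τ), ?_, ?_, ?_, ?_⟩
    · rw [hcf _ hτ', neg_neg]; ring
    · rw [hdf _ hτ', neg_neg]; ring
    · rw [← HP _ hτ']
      unfold Pf
      ring
    · rw [← HQ _ hτ']
      unfold Qf
      ring
  · exact core' α β _ ((c 0 - d 0) / 2) lo hi hα hβ h1 (by linarith [hz.1, hz.2])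
      fun τ hτ => ⟨c τ, d τ, r τ, hcf τ hτ, hdf τ hτ, HP τ hτ, HQ τ hτ⟩
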